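/- arXiv:2502.19709 — 2 statements merged into one kernel-verified Lean document; each statement's English description precedes it below -/
import Mathlib

section
/- Let (A1,[·,·]1,∘1) and (A2,[·,·]2,∘2) be Malcev-Poisson algebras over a field K of characteristic 0 and ρ1,μ1 : A1 → End(A2), ρ2,μ2 : A2 → End(A1) linear maps. Define on A1 ⊕ A2 the operations (x1+x2)∘(y1+y2) = x1∘1 y1 + μ2(x2)y1 + μ2(y2)x1 + x2∘2 y2 + μ1(x1)y2 + μ1(y1)x2 and [x1+x2, y1+y2] = [x1,y1]1 + ρ2(x2)y1 − ρ2(y2)x1 + [x2,y2]2 + ρ1(x1)y2 − ρ1(y1)x2. Then (A1 ⊕ A2, [·,·], ∘) is a Malcev-Poisson algebra if and only if (A1,A2,ρ1,μ1,ρ2,μ2) is a matched pair of Malcev-Poisson algebras. -/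
open scoped TensorProduct

namespace MPA

variable (K : Type*) [Field K] [CharZero K]

section Basic
variable {A B V : Type*}
variable [AddCommGroup A] [Module K A] [AddCommGroup B] [Module K B]
variable [AddCommGroup V] [Module K V]

/-- A two-argument map is bilinear. -/
def IsBilin (m : A → A → B) : Prop :=
  (∀ x : A, IsLinearMap K (m x)) ∧ (∀ y : A, IsLinearMap K fun x => m x y)

/-- Bundle a bilinear two-argument map. -/
def mkBilin (m : A → A → B) (h : IsBilin K m) : A →ₗ[K] A →ₗ[K] B :=
  LinearMap.mk₂ K m (fun x y z => (h.2 z).map_add x y) (fun c x y => (h.2 y).map_smul c x)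
    (fun x y z => (h.1 x).map_add y z) (fun c x y => (h.1 x).map_smul c y)

/-- Bundle the left multiplications of a bilinear map as endomorphisms. -/
def mkEnd (m : A → A → A) (h : IsBilin K m) : A → Module.End K A :=
  fun x => IsLinearMap.mk' (m x) (h.1 x)

/-- The Jacobian `J(x,y,z) = [[x,y],z] + [[z,x],y] + [[y,z],x]`. -/
def Jacobian (br : A → A → A) (x y z : A) : A :=
  br (br x y) z + br (br z x) y + br (br y z) x

/-- Antisymmetry. -/
def IsSkew (br : A → A → A) : Prop := ∀ x y, br x y = - br y x

/-- Sagle's identity. -/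
def SagleIdentity (br : A → A → A) : Prop :=
  ∀ x y z t, br (br x z) (br y t) =
    br (br (br x y) z) t + br (br (br y z) t) x + br (br (br z t) x) y + br (br (br t x) y) z

/-- A Malcev algebra structure: an antisymmetric bilinear bracket satisfying Sagle's identity. -/
def IsMalcev (br : A → A → A) : Prop :=
  IsBilin K br ∧ IsSkew br ∧ SagleIdentity br

/-- A commutative associative algebra structure given by a bilinear product. -/
def IsCommAssoc (m : A → A → A) : Prop :=
  IsBilin K m ∧ (∀ x y, m x y = m y x) ∧ ∀ x y z, m (m x y) z = m x (m y z)

/-- A Malcev-Poisson algebra: a Malcev bracket and a commutative associative product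
satisfying the Leibniz rule. -/
def IsMalcevPoisson (br m : A → A → A) : Prop :=
  IsMalcev K br ∧ IsCommAssoc K m ∧
    ∀ x y z, br x (m y z) = m (br x y) z + m y (br x z)

/-- The defining identity of a representation of a Malcev algebra. -/
def IsMalcevRepMap (br : A → A → A) (ρ : A → Module.End K V) : Prop :=
  ∀ x y z, ρ (br (br x y) z) =
    ρ z * ρ y * ρ x - ρ y * ρ x * ρ z + ρ x * ρ (br y z) + ρ (br x z) * ρ y

/-- A representation of a Malcev algebra. -/
def IsMalcevRep (br : A → A → A) (ρ : A → Module.End K V) : Prop :=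
  IsLinearMap K ρ ∧ IsMalcevRepMap K br ρ

/-- A representation of a (commutative) associative algebra. -/
def IsAssocRep (m : A → A → A) (μ : A → Module.End K V) : Prop :=
  IsLinearMap K μ ∧ ∀ x y, μ (m x y) = μ x * μ y

/-- A representation of a Malcev-Poisson algebra. -/
def IsMPRep (br m : A → A → A) (ρ μ : A → Module.End K V) : Prop :=
  IsMalcevRep K br ρ ∧ IsAssocRep K m μ ∧
  (∀ x y, ρ (m x y) = μ y * ρ x + μ x * ρ y) ∧
  (∀ x y, μ (br x y) = ρ x * μ y - μ y * ρ x)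

/-- An `A`-module Malcev algebra. -/
def IsModuleMalcevAlg (br : A → A → A) (brV : V → V → V) (ρ : A → Module.End K V) : Prop :=
  IsMalcev K brV ∧ IsMalcevRep K br ρ ∧
  (∀ x y a b, ρ (br x y) (brV a b) =
      ρ x (brV (ρ y a) b) - brV (ρ y (ρ x a)) b - brV (ρ x (ρ y b)) a + ρ y (brV (ρ x b) a)) ∧
  (∀ x y a b, brV (ρ x a) (ρ y b) =
      brV (ρ (br x y) a) b - ρ x (brV (ρ y a) b) + ρ y (ρ x (brV a b)) + brV (ρ y (ρ x b)) a) ∧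
  (∀ x a b c, brV (ρ x a) (brV b c) =
      brV (brV (ρ x b) a) c - ρ x (brV (brV b a) c) - brV (ρ x (brV a c)) b - brV (brV (ρ x c) b) a)

/-- An `A`-module associative algebra. -/
def IsModuleAssocAlg (m : A → A → A) (mV : V → V → V) (μ : A → Module.End K V) : Prop :=
  IsCommAssoc K mV ∧ IsAssocRep K m μ ∧ ∀ x a b, μ x (mV a b) = mV (μ x a) b

/-- An `A`-module Malcev-Poisson algebra. -/
def IsModuleMP (br m : A → A → A) (brV mV : V → V → V) (ρ μ : A → Module.End K V) : Prop :=
  IsModuleMalcevAlg K br brV ρ ∧ IsModuleAssocAlg K m mV μ ∧ IsMPRep K br m ρ μ ∧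
  (∀ x a b, ρ x (mV a b) = mV (ρ x a) b + mV a (ρ x b)) ∧
  (∀ x a b, brV a (μ x b) = - mV (ρ x a) b + μ x (brV a b))

/-- The sub-adjacent bracket `{x,y} = x◇y − y◇x + [x,y]` of a post-Malcev algebra. -/
def pmBr (br dia : A → A → A) : A → A → A := fun x y => dia x y - dia y x + br x y

/-- The associated product `x∘y = x▷y + y▷x + x·y` of a commutative dendriform trialgebra. -/
def trialMul (mdot tri : A → A → A) : A → A → A := fun x y => tri x y + tri y x + mdot x y

/-- A post-Malcev algebra. -/
def IsPostMalcev (br dia : A → A → A) : Prop :=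
  IsMalcev K br ∧ IsBilin K dia ∧
  (∀ x y z t, dia (pmBr br dia x z) (br y t) =
      dia x (br (dia z y) t) - br (dia z (dia x y)) t - br (dia x (dia z t)) y
        + dia z (br (dia x t) y)) ∧
  (∀ x y z t, br (dia x z) (dia y t) =
      br (dia (pmBr br dia x y) z) t - dia x (br (dia y z) t) + dia y (dia x (br z t))
        + br (dia y (dia x t)) z) ∧
  (∀ x y z t, br (dia x z) (br y t) =
      br (br (dia x y) z) t - dia x (br (br y z) t) - br (dia x (br z t)) y
        - br (br (dia x t) y) z) ∧
  (∀ x y z t, dia (pmBr br dia y z) (dia x t) =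
      dia (pmBr br dia (pmBr br dia x y) z) t + dia y (dia (pmBr br dia x z) t)
        + dia x (dia y (dia z t)) - dia z (dia x (dia y t)))

/-- A commutative dendriform trialgebra. -/
def IsCommTridend (mdot tri : A → A → A) : Prop :=
  IsCommAssoc K mdot ∧ IsBilin K tri ∧
  (∀ x y z, tri (trialMul mdot tri x y) z = tri x (tri y z)) ∧
  (∀ x y z, mdot (tri x y) z = tri x (mdot y z))

/-- A post-Malcev-Poisson algebra. -/
def IsPostMP (br dia mdot tri : A → A → A) : Prop :=
  IsMalcevPoisson K br mdot ∧ IsPostMalcev K br dia ∧ IsCommTridend K mdot tri ∧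
  (∀ x y z, dia x (mdot y z) = mdot (dia x y) z + mdot y (dia x z)) ∧
  (∀ x y z, br x (tri z y) = tri z (br x y) - mdot y (dia z x)) ∧
  (∀ x y z, dia (trialMul mdot tri y z) x = tri z (dia y x) + tri y (dia z x)) ∧
  (∀ x y z, tri (pmBr br dia x z) y = dia x (tri z y) - tri z (dia x y))

/-- The dual representation `ρ*(x) = −ρ(x)*`. -/
def dualRepNeg (ρ : A → Module.End K V) : A → Module.End K (Module.Dual K V) :=
  fun x => -(ρ x).dualMap

/-- The dual map `x ↦ μ(x)*` (used for `−μ*`). -/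
def dualRepPos (μ : A → Module.End K V) : A → Module.End K (Module.Dual K V) :=
  fun x => (μ x).dualMap

end Basic

section Matched
variable {A1 A2 : Type*} [AddCommGroup A1] [Module K A1] [AddCommGroup A2] [Module K A2]

/-- Identities (M1), (M3), (M5) of a matched pair of Malcev algebras. -/
def MalcevCompatHalf (br1 : A1 → A1 → A1) (br2 : A2 → A2 → A2)
    (ρ1 : A1 → Module.End K A2) (ρ2 : A2 → Module.End K A1) : Prop :=
  (∀ (x1 y1 z1 : A1) (x2 : A2),
      br1 (br1 (ρ2 x2 x1) y1) z1 - br1 (ρ2 x2 (br1 y1 z1)) x1 - br1 (ρ2 (ρ1 x1 x2) y1) z1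
      - br1 (br1 (ρ2 x2 z1) x1) y1 + ρ2 (ρ1 y1 (ρ1 x1 x2)) z1 + br1 (br1 x1 z1) (ρ2 x2 y1)
      - ρ2 x2 (br1 (br1 x1 y1) z1) + ρ2 (ρ1 y1 x2) (br1 x1 z1) + br1 (ρ2 (ρ1 z1 x2) x1) y1
      + ρ2 (ρ1 (br1 y1 z1) x2) x1 - ρ2 (ρ1 x1 (ρ1 z1 x2)) y1 = 0) ∧
  (∀ (x1 y1 : A1) (x2 y2 : A2),
      ρ2 (ρ1 x1 (br2 x2 y2)) y1 - ρ2 (ρ1 x1 x2) (ρ2 y2 y1) + ρ2 x2 (br1 (ρ2 y2 x1) y1)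
      - br1 (ρ2 y2 (ρ2 x2 y1)) x1 - br1 (ρ2 (br2 x2 y2) x1) y1 + ρ2 (ρ1 y1 y2) (ρ2 x2 x1)
      - ρ2 (br2 (ρ1 y1 x2) y2) x1 - ρ2 y2 (ρ2 x2 (br1 x1 y1)) + br1 (ρ2 x2 x1) (ρ2 y2 y1)
      - ρ2 x2 (ρ2 (ρ1 x1 y2) y1) + ρ2 (ρ1 (ρ2 x2 y1) y2) x1 = 0) ∧
  (∀ (x1 y1 : A1) (x2 y2 : A2),
      ρ2 x2 (br1 (ρ2 y2 y1) x1) - ρ2 (br2 (ρ1 x1 y2) x2) y1 - br1 (ρ2 x2 (ρ2 y2 x1)) y1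
      + ρ2 y2 (br1 (ρ2 x2 x1) y1) - br1 (ρ2 y2 (ρ2 x2 y1)) x1 - ρ2 (br2 (ρ1 y1 x2) y2) x1
      - ρ2 y2 (ρ2 (ρ1 x1 x2) y1) - ρ2 x2 (ρ2 (ρ1 y1 y2) x1) + ρ2 (br2 x2 y2) (br1 x1 y1)
      + ρ2 (ρ1 (ρ2 x2 y1) y2) x1 + ρ2 (ρ1 (ρ2 y2 x1) x2) y1 = 0)

/-- A matched pair of Malcev algebras. -/
def IsMatchedPairMalcev (br1 : A1 → A1 → A1) (br2 : A2 → A2 → A2)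
    (ρ1 : A1 → Module.End K A2) (ρ2 : A2 → Module.End K A1) : Prop :=
  IsMalcev K br1 ∧ IsMalcev K br2 ∧ IsMalcevRep K br1 ρ1 ∧ IsMalcevRep K br2 ρ2 ∧
  MalcevCompatHalf K br1 br2 ρ1 ρ2 ∧ MalcevCompatHalf K br2 br1 ρ2 ρ1

/-- A matched pair of commutative associative algebras. -/
def IsMatchedPairComm (m1 : A1 → A1 → A1) (m2 : A2 → A2 → A2)
    (μ1 : A1 → Module.End K A2) (μ2 : A2 → Module.End K A1) : Prop :=
  IsCommAssoc K m1 ∧ IsCommAssoc K m2 ∧ IsAssocRep K m1 μ1 ∧ IsAssocRep K m2 μ2 ∧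
  (∀ (x1 : A1) (x2 y2 : A2), μ1 x1 (m2 x2 y2) = m2 (μ1 x1 x2) y2 + μ1 (μ2 x2 x1) y2) ∧
  (∀ (x2 : A2) (x1 y1 : A1), μ2 x2 (m1 x1 y1) = m1 (μ2 x2 x1) y1 + μ2 (μ1 x1 x2) y1)

/-- A matched pair of Malcev-Poisson algebras. -/
def IsMatchedPairMP (br1 m1 : A1 → A1 → A1) (br2 m2 : A2 → A2 → A2)
    (ρ1 μ1 : A1 → Module.End K A2) (ρ2 μ2 : A2 → Module.End K A1) : Prop :=
  IsMatchedPairMalcev K br1 br2 ρ1 ρ2 ∧ IsMatchedPairComm K m1 m2 μ1 μ2 ∧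
  IsMPRep K br1 m1 ρ1 μ1 ∧ IsMPRep K br2 m2 ρ2 μ2 ∧
  (∀ (x2 : A2) (x1 y1 : A1),
      ρ2 x2 (m1 x1 y1) =
        m1 (ρ2 x2 x1) y1 + m1 x1 (ρ2 x2 y1) - μ2 (ρ1 x1 x2) y1 - μ2 (ρ1 y1 x2) x1) ∧
  (∀ (x1 : A1) (x2 y2 : A2),
      ρ1 x1 (m2 x2 y2) =
        m2 (ρ1 x1 x2) y2 + m2 x2 (ρ1 x1 y2) - μ1 (ρ2 x2 x1) y2 - μ1 (ρ2 y2 x1) x2) ∧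
  (∀ (x1 y1 : A1) (x2 : A2),
      br1 x1 (μ2 x2 y1) - ρ2 (μ1 y1 x2) x1 =
        μ2 (ρ1 x1 x2) y1 - m1 (ρ2 x2 x1) y1 + μ2 x2 (br1 x1 y1)) ∧
  (∀ (x2 y2 : A2) (x1 : A1),
      br2 x2 (μ1 x1 y2) - ρ1 (μ2 y2 x1) x2 =
        μ1 (ρ2 x2 x1) y2 - m2 (ρ1 x1 x2) y2 + μ1 x1 (br2 x2 y2))

/-- The bracket on the direct sum of a (candidate) matched pair. -/
def prodBr (br1 : A1 → A1 → A1) (br2 : A2 → A2 → A2)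
    (ρ1 : A1 → Module.End K A2) (ρ2 : A2 → Module.End K A1) :
    A1 × A2 → A1 × A2 → A1 × A2 :=
  fun p q => (br1 p.1 q.1 + ρ2 p.2 q.1 - ρ2 q.2 p.1, br2 p.2 q.2 + ρ1 p.1 q.2 - ρ1 q.1 p.2)

/-- The product on the direct sum of a (candidate) matched pair. -/
def prodMul (m1 : A1 → A1 → A1) (m2 : A2 → A2 → A2)
    (μ1 : A1 → Module.End K A2) (μ2 : A2 → Module.End K A1) :
    A1 × A2 → A1 × A2 → A1 × A2 :=
  fun p q => (m1 p.1 q.1 + μ2 p.2 q.1 + μ2 q.2 p.1, m2 p.2 q.2 + μ1 p.1 q.2 + μ1 q.1 p.2)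

end Matched

section Tensor
variable {A : Type*} [AddCommGroup A] [Module K A]

/-- The binary operation on the dual space induced by a comultiplication:
`⟨x, op(ξ,η)⟩ = ⟨δ(x), ξ⊗η⟩`. -/
noncomputable def dualOp (δ : A →ₗ[K] A ⊗[K] A) :
    Module.Dual K A → Module.Dual K A → Module.Dual K A :=
  fun ξ η => TensorProduct.lift (ξ.smulRight η) ∘ₗ δ

/-- The cyclic permutation `σ(x⊗y⊗z⊗t) = y⊗z⊗t⊗x`. -/
noncomputable def cyc4 : (((A ⊗[K] A) ⊗[K] A) ⊗[K] A) →ₗ[K] (((A ⊗[K] A) ⊗[K] A) ⊗[K] A) :=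
  (TensorProduct.comm K A ((A ⊗[K] A) ⊗[K] A)).toLinearMap ∘ₗ
    (TensorProduct.assoc K A (A ⊗[K] A) A).toLinearMap ∘ₗ
      (TensorProduct.congr (TensorProduct.assoc K A A A) (LinearEquiv.refl K A)).toLinearMap

/-- A Malcev coalgebra. -/
noncomputable def IsMalcevCoalg (δ : A →ₗ[K] A ⊗[K] A) : Prop :=
  ((TensorProduct.comm K A A).toLinearMap ∘ₗ δ = -δ) ∧
  ((TensorProduct.assoc K (A ⊗[K] A) A A).symm.toLinearMap ∘ₗ TensorProduct.map δ δ ∘ₗ δ =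
    (LinearMap.id + cyc4 K + cyc4 K ∘ₗ cyc4 K + cyc4 K ∘ₗ cyc4 K ∘ₗ cyc4 K) ∘ₗ
      TensorProduct.map (TensorProduct.map δ LinearMap.id) LinearMap.id ∘ₗ
        TensorProduct.map δ LinearMap.id ∘ₗ δ)

/-- A cocommutative coassociative coalgebra. -/
def IsCoCommCoassoc (Δ : A →ₗ[K] A ⊗[K] A) : Prop :=
  ((TensorProduct.comm K A A).toLinearMap ∘ₗ Δ = Δ) ∧
  (TensorProduct.map LinearMap.id Δ ∘ₗ Δ =
    (TensorProduct.assoc K A A A).toLinearMap ∘ₗ TensorProduct.map Δ LinearMap.id ∘ₗ Δ)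

/-- A Malcev-Poisson coalgebra. -/
noncomputable def IsMPCoalg (Δ δ : A →ₗ[K] A ⊗[K] A) : Prop :=
  IsCoCommCoassoc K Δ ∧ IsMalcevCoalg K δ ∧
  TensorProduct.map LinearMap.id Δ ∘ₗ δ
    - (TensorProduct.assoc K A A A).toLinearMap ∘ₗ TensorProduct.map δ LinearMap.id ∘ₗ Δ
    - (TensorProduct.leftComm K A A A).toLinearMap ∘ₗ TensorProduct.map LinearMap.id δ ∘ₗ Δ = 0

/-- The bracket as a linear map on the tensor square. -/
noncomputable def brTensor (br : A → A → A) (h : IsBilin K br) : A ⊗[K] A →ₗ[K] A :=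
  TensorProduct.lift (mkBilin K br h)

/-- `(id⊗m⊗id)(id⊗τ⊗id) : (a⊗b)⊗(c⊗d) ↦ a⊗([c,b]⊗d)`. -/
noncomputable def mixA (br : A → A → A) (h : IsBilin K br) :
    (A ⊗[K] A) ⊗[K] (A ⊗[K] A) →ₗ[K] A ⊗[K] (A ⊗[K] A) :=
  TensorProduct.map LinearMap.id (TensorProduct.map (brTensor K br h) LinearMap.id) ∘ₗ
    TensorProduct.map LinearMap.id (TensorProduct.assoc K A A A).symm.toLinearMap ∘ₗ
      TensorProduct.map LinearMap.id (TensorProduct.leftComm K A A A).toLinearMap ∘ₗ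
        (TensorProduct.assoc K A A (A ⊗[K] A)).toLinearMap

/-- `(id⊗id⊗m)(id⊗τ⊗id) : (a⊗b)⊗(c⊗d) ↦ a⊗(c⊗[b,d])`. -/
noncomputable def mixB (br : A → A → A) (h : IsBilin K br) :
    (A ⊗[K] A) ⊗[K] (A ⊗[K] A) →ₗ[K] A ⊗[K] (A ⊗[K] A) :=
  TensorProduct.map LinearMap.id (TensorProduct.map LinearMap.id (brTensor K br h)) ∘ₗ
    TensorProduct.map LinearMap.id (TensorProduct.leftComm K A A A).toLinearMap ∘ₗ
      (TensorProduct.assoc K A A (A ⊗[K] A)).toLinearMap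

/-- Compatibility condition (B1) of a Malcev bialgebra. -/
def MalcevBialgB1 (br : A → A → A) (h : IsBilin K br) (δ : A →ₗ[K] A ⊗[K] A) : Prop :=
  ∀ x y z : A,
    δ (br (br x y) z)
      + TensorProduct.map LinearMap.id (mkEnd K br h x) (δ (br y z))
      + TensorProduct.map (mkEnd K br h y) LinearMap.id (δ (br x z))
    = TensorProduct.map (mkEnd K br h (br z y)) LinearMap.id (δ x)
      + TensorProduct.map (mkEnd K br h z) (mkEnd K br h y) (δ x)
      + TensorProduct.map LinearMap.id (mkEnd K br h z ∘ₗ mkEnd K br h y) (δ x)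
      - TensorProduct.map (mkEnd K br h z ∘ₗ mkEnd K br h x) LinearMap.id (δ y)
      - TensorProduct.map (mkEnd K br h x) (mkEnd K br h z) (δ y)
      + TensorProduct.map LinearMap.id (mkEnd K br h (br x z)) (δ y)
      + TensorProduct.map (mkEnd K br h x ∘ₗ mkEnd K br h y) LinearMap.id (δ z)
      - TensorProduct.map LinearMap.id (mkEnd K br h y ∘ₗ mkEnd K br h x) (δ z)

/-- Compatibility condition (B2) of a Malcev bialgebra. -/
noncomputable def MalcevBialgB2 (br : A → A → A) (h : IsBilin K br) (δ : A →ₗ[K] A ⊗[K] A) :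
    Prop :=
  ∀ x y : A,
    TensorProduct.map LinearMap.id δ (δ (br x y))
    = TensorProduct.map LinearMap.id (TensorProduct.map LinearMap.id (mkEnd K br h x))
        (TensorProduct.map LinearMap.id δ (δ y))
      + (TensorProduct.assoc K A A A).toLinearMap
          (TensorProduct.map δ LinearMap.id (TensorProduct.map (mkEnd K br h x) LinearMap.id (δ y)))
      + mixA K br h (δ y ⊗ₜ[K] δ x)
      - TensorProduct.map (mkEnd K br h y) LinearMap.id
          ((TensorProduct.assoc K A A A).toLinearMap (TensorProduct.map δ LinearMap.id (δ x)))
      - TensorProduct.map LinearMap.id (TensorProduct.map LinearMap.id (mkEnd K br h y))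
          ((TensorProduct.assoc K A A A).toLinearMap (TensorProduct.map δ LinearMap.id (δ x)))
      + mixB K br h (δ x ⊗ₜ[K] δ y)
      - TensorProduct.map LinearMap.id (TensorProduct.comm K A A).toLinearMap
          (TensorProduct.map LinearMap.id (TensorProduct.map LinearMap.id (mkEnd K br h x))
            ((TensorProduct.assoc K A A A).toLinearMap (TensorProduct.map δ LinearMap.id (δ y))))
      + TensorProduct.map LinearMap.id (TensorProduct.comm K A A).toLinearMap
          ((TensorProduct.assoc K A A A).toLinearMap
            (TensorProduct.map δ LinearMap.id (TensorProduct.map (mkEnd K br h y) LinearMap.id (δ x))))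
      - TensorProduct.map LinearMap.id (TensorProduct.map (mkEnd K br h y) LinearMap.id)
          (TensorProduct.map LinearMap.id δ (δ x))
      + TensorProduct.map LinearMap.id (TensorProduct.comm K A A).toLinearMap
          (TensorProduct.map (mkEnd K br h x) LinearMap.id
            ((TensorProduct.assoc K A A A).toLinearMap (TensorProduct.map δ LinearMap.id (δ y))))

end Tensor

section Coadj
variable {A : Type*} [AddCommGroup A] [Module K A] [Module.IsReflexive K A]

/-- The coadjoint-type action of a bracket on the dual space, transported back to `A`
through the canonical isomorphism `A ≃ A**`:
`⟨coadjDouble(ξ)x, η⟩ = −⟨x, [ξ,η]*⟩`. -/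
noncomputable def coadjDouble (brS : Module.Dual K A → Module.Dual K A → Module.Dual K A)
    (h : IsBilin K brS) : Module.Dual K A → Module.End K A :=
  fun ξ => -((Module.evalEquiv K A).symm.toLinearMap ∘ₗ
      (IsLinearMap.mk' (brS ξ) (h.1 ξ)).dualMap ∘ₗ (Module.evalEquiv K A).toLinearMap)

/-- `⟨comulDouble(ξ)x, η⟩ = ⟨x, ξ∘η⟩` : the action `−L*` of the dual product, transported
back to `A` through `A ≃ A**`. -/
noncomputable def comulDouble (mS : Module.Dual K A → Module.Dual K A → Module.Dual K A)
    (h : IsBilin K mS) : Module.Dual K A → Module.End K A :=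
  fun ξ => (Module.evalEquiv K A).symm.toLinearMap ∘ₗ
      (IsLinearMap.mk' (mS ξ) (h.1 ξ)).dualMap ∘ₗ (Module.evalEquiv K A).toLinearMap

end Coadj

section DirectSum

variable {𝕜 : Type*} [Field 𝕜]

section Sagle
variable {A : Type*} [AddCommGroup A] [Module 𝕜 A] {br : A → A → A}

/-- The defect of Sagle's identity. -/
def sagleDefect (br : A → A → A) (x y z t : A) : A :=
  br (br (br x y) z) t + br (br (br y z) t) x + br (br (br z t) x) y + br (br (br t x) y) z
    - br (br x z) (br y t)

theorem sagleIdentity_iff_sagleDefect :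
    SagleIdentity br ↔ ∀ x y z t, sagleDefect br x y z t = 0 := by
  simp only [SagleIdentity, sagleDefect, sub_eq_zero, eq_comm]

theorem sagleDefect_rotate (hb : IsBilin 𝕜 br) (hs : IsSkew br) (x y z t : A) :
    sagleDefect br x y z t = sagleDefect br y z t x := by
  have h : br (br y t) (br z x) = br (br x z) (br y t) := by
    rw [hs (br y t), hs z x, (hb.2 _).map_neg, neg_neg]
  simp only [sagleDefect, h]
  abel

theorem sagleDefect_add (hb : IsBilin 𝕜 br) (x x' y z t : A) :
    sagleDefect br (x + x') y z t = sagleDefect br x y z t + sagleDefect br x' y z t := by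
  have hl (a b c : A) : br (a + b) c = br a c + br b c := (hb.2 c).map_add a b
  have hr (a b c : A) : br a (b + c) = br a b + br a c := (hb.1 a).map_add b c
  simp only [sagleDefect, hl, hr]
  abel

theorem IsBilin.exists_linearMap (hb : IsBilin 𝕜 br) :
    ∃ b : A →ₗ[𝕜] A →ₗ[𝕜] A, br = fun x y => b x y :=
  ⟨mkBilin 𝕜 br hb, rfl⟩

theorem isBilin_linearMap (b : A →ₗ[𝕜] A →ₗ[𝕜] A) : IsBilin 𝕜 fun x y => b x y :=
  ⟨fun x => (b x).isLinear, fun y => (b.flip y).isLinear⟩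

end Sagle

/-- A cyclically invariant function of four arguments in `A × B` that is additive in each of
them vanishes as soon as it vanishes on arguments from the two summands. -/
theorem eq_zero_of_rotate_of_add {A B C : Type*} [AddCommGroup A] [AddCommGroup B]
    [AddCommGroup C] {F : A × B → A × B → A × B → A × B → C}
    (hrot : ∀ p q r s, F p q r s = F q r s p)
    (hadd : ∀ p p' q r s, F (p + p') q r s = F p q r s + F p' q r s)
    (h₀ : ∀ a b c d, F (a, 0) (b, 0) (c, 0) (d, 0) = 0)
    (h₁ : ∀ a b c d, F (a, 0) (b, 0) (c, 0) (0, d) = 0)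
    (h₂ : ∀ a b c d, F (a, 0) (b, 0) (0, c) (0, d) = 0)
    (h₂' : ∀ a b c d, F (a, 0) (0, b) (c, 0) (0, d) = 0)
    (h₃ : ∀ a b c d, F (a, 0) (0, b) (0, c) (0, d) = 0)
    (h₄ : ∀ a b c d, F (0, a) (0, b) (0, c) (0, d) = 0) (p q r s : A × B) :
    F p q r s = 0 := by
  have ind (q r s : A × B) (ha : ∀ a, F (a, 0) q r s = 0) (hb : ∀ b, F (0, b) q r s = 0)
      (p : A × B) : F p q r s = 0 := by
    rw [← p.fst_add_snd, hadd, ha, hb, add_zero]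
  have rot {p q r s : A × B} (h : F q r s p = 0) : F p q r s = 0 := (hrot p q r s).trans h
  refine ind _ _ _ (fun a => ?_) (fun a => ?_) p <;> refine rot ?_ <;>
  refine ind _ _ _ (fun b => ?_) (fun b => ?_) q <;> refine rot ?_ <;>
  refine ind _ _ _ (fun c => ?_) (fun c => ?_) r <;> refine rot ?_ <;>
  refine ind _ _ _ (fun d => ?_) (fun d => ?_) s <;>
  grind only

variable {A1 A2 : Type*} [AddCommGroup A1] [Module 𝕜 A1] [AddCommGroup A2] [Module 𝕜 A2]

theorem isSkew_prodBr {br1 : A1 → A1 → A1} {br2 : A2 → A2 → A2} (hs1 : IsSkew br1)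
    (hs2 : IsSkew br2) (ρ1 : A1 → Module.End 𝕜 A2) (ρ2 : A2 → Module.End 𝕜 A1) :
    IsSkew (prodBr 𝕜 br1 br2 ρ1 ρ2) := by
  intro p q
  ext
  · simp only [prodBr, hs1 p.1, Prod.fst_neg]
    abel
  · simp only [prodBr, hs2 p.2, Prod.snd_neg]
    abel

section Bundled
variable (b1 : A1 →ₗ[𝕜] A1 →ₗ[𝕜] A1) (b2 : A2 →ₗ[𝕜] A2 →ₗ[𝕜] A2)
variable (m1 : A1 →ₗ[𝕜] A1 →ₗ[𝕜] A1) (m2 : A2 →ₗ[𝕜] A2 →ₗ[𝕜] A2)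
variable (ρ1 μ1 : A1 →ₗ[𝕜] Module.End 𝕜 A2) (ρ2 μ2 : A2 →ₗ[𝕜] Module.End 𝕜 A1)

theorem isBilin_prodBr : IsBilin 𝕜 (prodBr 𝕜 (b1 · ·) (b2 · ·) ρ1 ρ2) := by
  refine ⟨fun p => ⟨fun q r => ?_, fun c q => ?_⟩, fun p => ⟨fun q r => ?_, fun c q => ?_⟩⟩ <;>
  ext <;> simp [prodBr, smul_sub, smul_add] <;> abel

theorem isBilin_prodMul : IsBilin 𝕜 (prodMul 𝕜 (m1 · ·) (m2 · ·) μ1 μ2) := by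
  refine ⟨fun p => ⟨fun q r => ?_, fun c q => ?_⟩, fun p => ⟨fun q r => ?_, fun c q => ?_⟩⟩ <;>
  ext <;> simp [prodMul, smul_add] <;> abel

variable {b1 b2 m1 m2 ρ1 μ1 ρ2 μ2}

set_option maxHeartbeats 800000 in
theorem fst_sagleDefect_prodBr_iff (hs1 : IsSkew (b1 · ·)) (hs2 : IsSkew (b2 · ·))
    (hS : SagleIdentity (b1 · ·)) :
    (∀ p q r s, (sagleDefect (prodBr 𝕜 (b1 · ·) (b2 · ·) ρ1 ρ2) p q r s).1 = 0) ↔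
      IsMalcevRepMap 𝕜 (b2 · ·) ρ2 ∧ MalcevCompatHalf 𝕜 (b1 · ·) (b2 · ·) ρ1 ρ2 := by
  have hB := isBilin_prodBr b1 b2 ρ1 ρ2
  have hS' := isSkew_prodBr hs1 hs2 ρ1 ρ2
  rw [sagleIdentity_iff_sagleDefect] at hS
  constructor
  · intro h
    refine ⟨fun x y z => LinearMap.ext fun w => ?_, fun x y z w => ?_, fun x y z w => ?_,
      fun x y z w => ?_⟩
    · have h := h (w, 0) (0, x) (0, y) (0, z)
      simp [sagleDefect, prodBr] at h ⊢
      grind [IsSkew]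
    · have h := h (x, 0) (y, 0) (z, 0) (0, w)
      simp [sagleDefect, prodBr] at h ⊢
      grind [IsSkew]
    · have h := h (x, 0) (y, 0) (0, z) (0, w)
      simp [sagleDefect, prodBr] at h ⊢
      grind [IsSkew]
    · have h := h (x, 0) (0, z) (y, 0) (0, w)
      simp [sagleDefect, prodBr] at h ⊢
      grind [IsSkew]
  · rintro ⟨hR, hM1, hM3, hM5⟩
    refine eq_zero_of_rotate_of_add (fun p q r s => by rw [sagleDefect_rotate hB hS'])
      (fun p p' q r s => by rw [sagleDefect_add hB, Prod.fst_add]) (fun x y z w => ?_)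
      (fun x y z w => ?_) (fun x y z w => ?_) (fun x y z w => ?_) (fun x y z w => ?_)
      (fun x y z w => ?_)
    · simpa [sagleDefect, prodBr] using hS x y z w
    · have h := hM1 x y z w
      simp [sagleDefect, prodBr] at h ⊢
      grind [IsSkew]
    · have h := hM3 x y z w
      simp [sagleDefect, prodBr] at h ⊢
      grind [IsSkew]
    · have h := hM5 x z y w
      simp [sagleDefect, prodBr] at h ⊢
      grind [IsSkew]
    · have h := LinearMap.congr_fun (hR y z w) x
      simp [sagleDefect, prodBr] at h ⊢
      grind [IsSkew]
    · simp [sagleDefect, prodBr]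

theorem fst_prodMul_assoc_iff (hc : ∀ x y, m1 x y = m1 y x)
    (ha : ∀ x y z, m1 (m1 x y) z = m1 x (m1 y z)) (hc2 : ∀ x y, m2 x y = m2 y x) :
    (∀ p q r, (prodMul 𝕜 (m1 · ·) (m2 · ·) μ1 μ2 (prodMul 𝕜 (m1 · ·) (m2 · ·) μ1 μ2 p q) r).1 =
      (prodMul 𝕜 (m1 · ·) (m2 · ·) μ1 μ2 p (prodMul 𝕜 (m1 · ·) (m2 · ·) μ1 μ2 q r)).1) ↔
    (∀ x y, μ2 (m2 x y) = μ2 x * μ2 y) ∧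
      ∀ x2 x1 y1, μ2 x2 (m1 x1 y1) = m1 (μ2 x2 x1) y1 + μ2 (μ1 x1 x2) y1 := by
  constructor
  · intro h
    refine ⟨fun x y => LinearMap.ext fun w => ?_, fun x2 x1 y1 => ?_⟩
    · simpa [prodMul] using h (0, x) (0, y) (w, 0)
    · simpa [prodMul] using (h (0, x2) (x1, 0) (y1, 0)).symm
  · rintro ⟨hM, hC⟩ ⟨x1, x2⟩ ⟨y1, y2⟩ ⟨z1, z2⟩
    have hM' (x y w) : μ2 (m2 x y) w = μ2 x (μ2 y w) := LinearMap.congr_fun (hM x y) w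
    have hM'' (x y w) : μ2 x (μ2 y w) = μ2 y (μ2 x w) := by rw [← hM', hc2, hM']
    simp [prodMul, hM', hC, ha]
    grind

theorem fst_leibniz_iff (hc : ∀ x y, m1 x y = m1 y x)
    (hL : ∀ x y z, b1 x (m1 y z) = m1 (b1 x y) z + m1 y (b1 x z)) :
    (∀ p q r, (prodBr 𝕜 (b1 · ·) (b2 · ·) ρ1 ρ2 p (prodMul 𝕜 (m1 · ·) (m2 · ·) μ1 μ2 q r)).1 =
      (prodMul 𝕜 (m1 · ·) (m2 · ·) μ1 μ2 (prodBr 𝕜 (b1 · ·) (b2 · ·) ρ1 ρ2 p q) r +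
        prodMul 𝕜 (m1 · ·) (m2 · ·) μ1 μ2 q (prodBr 𝕜 (b1 · ·) (b2 · ·) ρ1 ρ2 p r)).1) ↔
    (∀ x y, ρ2 (m2 x y) = μ2 y * ρ2 x + μ2 x * ρ2 y) ∧
    (∀ x y, μ2 (b2 x y) = ρ2 x * μ2 y - μ2 y * ρ2 x) ∧
    (∀ x2 x1 y1, ρ2 x2 (m1 x1 y1) =
      m1 (ρ2 x2 x1) y1 + m1 x1 (ρ2 x2 y1) - μ2 (ρ1 x1 x2) y1 - μ2 (ρ1 y1 x2) x1) ∧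
    (∀ x1 y1 x2, b1 x1 (μ2 x2 y1) - ρ2 (μ1 y1 x2) x1 =
      μ2 (ρ1 x1 x2) y1 - m1 (ρ2 x2 x1) y1 + μ2 x2 (b1 x1 y1)) := by
  constructor
  · intro h
    refine ⟨fun x y => LinearMap.ext fun w => ?_, fun x y => LinearMap.ext fun w => ?_,
      fun x2 x1 y1 => ?_, fun x1 y1 x2 => ?_⟩
    · have h := h (w, 0) (0, x) (0, y)
      simp [prodMul, prodBr] at h ⊢
      grind
    · have h := h (0, x) (0, y) (w, 0)
      simp [prodMul, prodBr] at h ⊢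
      grind
    · have h := h (0, x2) (x1, 0) (y1, 0)
      simp [prodMul, prodBr] at h ⊢
      grind
    · have h := h (x1, 0) (y1, 0) (0, x2)
      simp [prodMul, prodBr] at h ⊢
      grind
  · rintro ⟨hρ, hμ, hm, hb⟩ ⟨x1, x2⟩ ⟨y1, y2⟩ ⟨z1, z2⟩
    have hρ' (x y w) : ρ2 (m2 x y) w = μ2 y (ρ2 x w) + μ2 x (ρ2 y w) :=
      LinearMap.congr_fun (hρ x y) w
    have hμ' (x y w) : μ2 (b2 x y) w = ρ2 x (μ2 y w) - μ2 y (ρ2 x w) :=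
      LinearMap.congr_fun (hμ x y) w
    simp [prodMul, prodBr, hρ', hμ', hm, hL]
    have h1 := hb x1 y1 z2
    have h2 := hb x1 z1 y2
    grind

end Bundled

end DirectSum

/-- The direct sum operations of two Malcev-Poisson algebras with two pairs
of linear actions form a Malcev-Poisson algebra iff `(A1,A2,ρ1,μ1,ρ2,μ2)` is a matched
pair of Malcev-Poisson algebras. -/
theorem prod_isMalcevPoisson_iff_matchedPairMP
    {A1 A2 : Type*} [AddCommGroup A1] [Module K A1] [AddCommGroup A2] [Module K A2]
    (br1 m1 : A1 → A1 → A1) (h1 : IsMalcevPoisson K br1 m1)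
    (br2 m2 : A2 → A2 → A2) (h2 : IsMalcevPoisson K br2 m2)
    (ρ1 μ1 : A1 → Module.End K A2) (hρ1 : IsLinearMap K ρ1) (hμ1 : IsLinearMap K μ1)
    (ρ2 μ2 : A2 → Module.End K A1) (hρ2 : IsLinearMap K ρ2) (hμ2 : IsLinearMap K μ2) :
    IsMalcevPoisson K (prodBr K br1 br2 ρ1 ρ2) (prodMul K m1 m2 μ1 μ2) ↔
      IsMatchedPairMP K br1 m1 br2 m2 ρ1 μ1 ρ2 μ2 := by
  obtain ⟨⟨hb1, hs1, hS1⟩, ⟨hbm1, hc1, ha1⟩, hL1⟩ := id h1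
  obtain ⟨⟨hb2, hs2, hS2⟩, ⟨hbm2, hc2, ha2⟩, hL2⟩ := id h2
  obtain ⟨b1, rfl⟩ := hb1.exists_linearMap
  obtain ⟨b2, rfl⟩ := hb2.exists_linearMap
  obtain ⟨m1, rfl⟩ := hbm1.exists_linearMap
  obtain ⟨m2, rfl⟩ := hbm2.exists_linearMap
  obtain ⟨ρ1, rfl⟩ : ∃ f : A1 →ₗ[K] Module.End K A2, ρ1 = f := ⟨hρ1.mk', rfl⟩
  obtain ⟨μ1, rfl⟩ : ∃ f : A1 →ₗ[K] Module.End K A2, μ1 = f := ⟨hμ1.mk', rfl⟩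
  obtain ⟨ρ2, rfl⟩ : ∃ f : A2 →ₗ[K] Module.End K A1, ρ2 = f := ⟨hρ2.mk', rfl⟩
  obtain ⟨μ2, rfl⟩ : ∃ f : A2 →ₗ[K] Module.End K A1, μ2 = f := ⟨hμ2.mk', rfl⟩
  have hS := fst_sagleDefect_prodBr_iff (ρ1 := ρ1) (ρ2 := ρ2) hs1 hs2 hS1
  have hS' := fst_sagleDefect_prodBr_iff (ρ1 := ρ2) (ρ2 := ρ1) hs2 hs1 hS2
  have hA := fst_prodMul_assoc_iff (m2 := m2) (μ1 := μ1) (μ2 := μ2) hc1 ha1 hc2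
  have hA' := fst_prodMul_assoc_iff (m2 := m1) (μ1 := μ2) (μ2 := μ1) hc2 ha2 hc1
  have hL := fst_leibniz_iff (b2 := b2) (m2 := m2) (ρ1 := ρ1) (ρ2 := ρ2) (μ1 := μ1) (μ2 := μ2)
    hc1 hL1
  have hL' := fst_leibniz_iff (b2 := b1) (m2 := m1) (ρ1 := ρ2) (ρ2 := ρ1) (μ1 := μ2) (μ2 := μ1)
    hc2 hL2
  constructor
  · rintro ⟨⟨-, -, hS₀⟩, ⟨-, -, hA₀⟩, hL₀⟩
    rw [sagleIdentity_iff_sagleDefect] at hS₀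
    obtain ⟨hR2, hM⟩ := hS.1 fun p q r s => congrArg Prod.fst (hS₀ p q r s)
    obtain ⟨hR1, hM'⟩ := hS'.1 fun p q r s =>
      congrArg Prod.snd (hS₀ p.swap q.swap r.swap s.swap)
    obtain ⟨hμμ2, hC2⟩ := hA.1 fun p q r => congrArg Prod.fst (hA₀ p q r)
    obtain ⟨hμμ1, hC1⟩ := hA'.1 fun p q r => congrArg Prod.snd (hA₀ p.swap q.swap r.swap)
    obtain ⟨hρm2, hμb2, hD2, hE2⟩ := hL.1 fun p q r => congrArg Prod.fst (hL₀ p q r)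
    obtain ⟨hρm1, hμb1, hD1, hE1⟩ := hL'.1 fun p q r =>
      congrArg Prod.snd (hL₀ p.swap q.swap r.swap)
    exact ⟨⟨h1.1, h2.1, ⟨hρ1, hR1⟩, ⟨hρ2, hR2⟩, hM, hM'⟩,
      ⟨h1.2.1, h2.2.1, ⟨hμ1, hμμ1⟩, ⟨hμ2, hμμ2⟩, hC1, hC2⟩,
      ⟨⟨hρ1, hR1⟩, ⟨hμ1, hμμ1⟩, hρm1, hμb1⟩, ⟨⟨hρ2, hR2⟩, ⟨hμ2, hμμ2⟩, hρm2, hμb2⟩,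
      hD2, hD1, hE2, hE1⟩
  · rintro ⟨⟨-, -, -, -, hM, hM'⟩, ⟨-, -, -, -, hC1, hC2⟩,
      ⟨⟨-, hR1⟩, ⟨-, hμμ1⟩, hρm1, hμb1⟩, ⟨⟨-, hR2⟩, ⟨-, hμμ2⟩, hρm2, hμb2⟩, hD2, hD1, hE2, hE1⟩
    refine ⟨⟨isBilin_prodBr b1 b2 ρ1 ρ2, isSkew_prodBr hs1 hs2 ρ1 ρ2,
      sagleIdentity_iff_sagleDefect.2 fun p q r s => ?_⟩,
      ⟨isBilin_prodMul m1 m2 μ1 μ2, fun p q => ?_, fun p q r => ?_⟩, fun p q r => ?_⟩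
    · exact Prod.ext (hS.2 ⟨hR2, hM⟩ p q r s) (hS'.2 ⟨hR1, hM'⟩ p.swap q.swap r.swap s.swap)
    · simp only [prodMul, hc1 p.1, hc2 p.2, add_right_comm]
    · exact Prod.ext (hA.2 ⟨hμμ2, hC2⟩ p q r) (hA'.2 ⟨hμμ1, hC1⟩ p.swap q.swap r.swap)
    · exact Prod.ext (hL.2 ⟨hρm2, hμb2, hD2, hE2⟩ p q r)
        (hL'.2 ⟨hρm1, hμb1, hD1, hE1⟩ p.swap q.swap r.swap)

end MPA
end

section
/- Let (A,∘) be a commutative associative algebra over a field K of characteristic 0, (V,∘_V,μ) an A-module associative algebra, λ ∈ K, and R : V → A a weighted relative Rota-Baxter operator of weight λ, i.e. R(a)∘R(b) = R(μ(R(a))b + μ(R(b))a + λ a∘_V b) for all a,b ∈ V. Then the operations a·b := λ a∘_V b and a▷b := μ(R(a))b make (V,·,▷) a commutative dendriform trialgebra. -/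
open scoped TensorProduct

namespace MPA

variable (K : Type*) [Field K] [CharZero K]

/-- A weighted relative Rota-Baxter operator of weight `λ` on a commutative
associative algebra induces a commutative dendriform trialgebra on the module, with
`a·b = λ a∘_V b` and `a▷b = μ(R(a))b`. -/
theorem weightedRB_comm_gives_commTridend
    {A V : Type*} [AddCommGroup A] [Module K A] [AddCommGroup V] [Module K V]
    (m : A → A → A) (hm : IsCommAssoc K m)
    (mV : V → V → V) (μ : A → Module.End K V)
    (hmod : IsModuleAssocAlg K m mV μ) (lam : K) (R : V →ₗ[K] A)
    (hR : ∀ a b : V, m (R a) (R b) = R (μ (R a) b + μ (R b) a + lam • mV a b)) :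
    IsCommTridend K (fun a b => lam • mV a b) (fun a b => μ (R a) b) := by
  obtain ⟨⟨⟨mV_right, mV_left⟩, mV_comm, mV_assoc⟩, ⟨μ_lin, μ_mul⟩, μ_mV⟩ := hmod
  refine ⟨⟨⟨fun x => ⟨fun a b => ?_, fun c a => ?_⟩, fun y => ⟨fun a b => ?_, fun c a => ?_⟩⟩,
    fun x y => ?_, fun x y z => ?_⟩,
    ⟨fun x => (μ (R x)).isLinear, fun y => ⟨fun a b => ?_, fun c a => ?_⟩⟩,
    fun x y z => ?_, fun x y z => ?_⟩
  · simp only [(mV_right x).map_add, smul_add]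
  · simp only [(mV_right x).map_smul, smul_comm lam c]
  · simp only [(mV_left y).map_add, smul_add]
  · simp only [(mV_left y).map_smul, smul_comm lam c]
  · simp only [mV_comm x y]
  · simp only [(mV_left z).map_smul, (mV_right x).map_smul, mV_assoc]
  · simp only [map_add, μ_lin.map_add, LinearMap.add_apply]
  · simp only [map_smul, μ_lin.map_smul, LinearMap.smul_apply]
  · simp only [trialMul, ← hR, μ_mul, Module.End.mul_apply]
  · simp only [map_smul, μ_mV]

end MPA
end
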